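/- For every parallelized finite automaton (PFA) P with n states, there exists a deterministic finite automaton A with at most 2^n states such that L(P) = L(A). In particular, every language defined by a PFA is regular. -/

import Mathlib

/-- A Parallelized Finite Automaton (PFA): transitions fire from a *set* of
source states read simultaneously. -/
structure PFA (Q : Type*) (σ : Type*) where
  Δ : Set (Set Q × σ × Q)
  I : Set Q
  F : Set Q

namespace PFA

variable {Q σ : Type*} (M : PFA Q σ)

/-- `RunTo M s q` holds iff there is a run tree of `M` over the string `s`
whose root is labeled `q`: leaves (over the empty string) are initial states,
and a node over `s ++ [a]` is justified by a transition `(P, a, q) ∈ Δ` whose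
predecessor set `P` is exactly the set of labels of its children, each of which
roots a run tree over `s`. -/
inductive RunTo (M : PFA Q σ) : List σ → Q → Prop where
  | leaf (q : Q) (h : q ∈ M.I) : RunTo M [] q
  | node (s : List σ) (a : σ) (q : Q) (P : Set Q) (h : (P, a, q) ∈ M.Δ)
      (child : ∀ p ∈ P, RunTo M s p) : RunTo M (s ++ [a]) q

/-- `M` accepts `s` iff some run tree over `s` has its root labeled by a final state. -/
def Accepts (s : List σ) : Prop := ∃ q ∈ M.F, M.RunTo s q

/-- The language of a PFA. -/
def language : Language σ := {s | M.Accepts s}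

end PFA

namespace PFA

variable {Q σ : Type*} (M : PFA Q σ)

theorem runTo_nil_iff {q : Q} : M.RunTo [] q ↔ q ∈ M.I := by
  refine ⟨fun h => ?_, RunTo.leaf q⟩
  generalize hs : ([] : List σ) = s at h
  cases h with
  | leaf _ h => exact h
  | node s a _ P h child => simp at hs

theorem runTo_append_singleton_iff {s : List σ} {a : σ} {q : Q} :
    M.RunTo (s ++ [a]) q ↔ ∃ P, (P, a, q) ∈ M.Δ ∧ ∀ p ∈ P, M.RunTo s p := by
  refine ⟨fun h => ?_, fun ⟨P, h, child⟩ => RunTo.node s a q P h child⟩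
  generalize hs : s ++ [a] = t at h
  cases h with
  | leaf _ h => simp at hs
  | node s' a' _ P h child =>
    obtain ⟨rfl, ha⟩ := List.append_inj' hs rfl
    obtain rfl := List.singleton_injective ha
    exact ⟨P, h, child⟩

/-- The subset construction: the state reached on `s` is the set of roots of run trees
over `s`. -/
def toDFA : DFA σ (Set Q) where
  step S a := {q | ∃ P ⊆ S, (P, a, q) ∈ M.Δ}
  start := M.I
  accept := {S | ∃ q ∈ M.F, q ∈ S}

theorem toDFA_eval (s : List σ) : M.toDFA.eval s = {q | M.RunTo s q} := by
  induction s using List.reverseRecOn with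
  | nil =>
    ext q
    exact M.runTo_nil_iff.symm
  | append_singleton s a ih =>
    rw [DFA.eval_append_singleton, ih]
    ext q
    rw [Set.mem_ofPred_eq, runTo_append_singleton_iff]
    exact exists_congr fun P => and_comm

theorem accepts_iff_mem_toDFA_accepts (s : List σ) : M.Accepts s ↔ s ∈ M.toDFA.accepts := by
  change _ ↔ M.toDFA.eval s ∈ M.toDFA.accept
  rw [toDFA_eval]
  rfl

end PFA

/-- For every PFA `P` with `n` states there exists a DFA `A`
with at most `2 ^ n` states recognizing the same language; in particular, every
language defined by a PFA is regular. -/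
theorem pfa_to_dfa {Q σ : Type} [Fintype Q] (M : PFA Q σ) :
    (∃ (Q' : Type) (_ : Fintype Q') (A : DFA σ Q'),
        Fintype.card Q' ≤ 2 ^ Fintype.card Q ∧
        ∀ s : List σ, M.Accepts s ↔ s ∈ A.accepts) ∧
    M.language.IsRegular := by
  classical
  exact ⟨⟨Set Q, inferInstance, M.toDFA, Fintype.card_set.le, M.accepts_iff_mem_toDFA_accepts⟩,
    ⟨Set Q, inferInstance, M.toDFA,
      Set.ext fun s => (M.accepts_iff_mem_toDFA_accepts s).symm⟩⟩
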